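/- Let d ≥ 3 and M ≥ 1 be integers. For all integers k ≥ 1 and t ≥ 1, G(t + M, k) ≤ (3/4)^d · G(t, k). -/

import Mathlib

/-- The vertices of the rooted `d`-ary tree of depth `k`: sequences over `Fin d`
of length at most `k`.  The root is the empty sequence, the children of a vertex
`l` with `l.length < k` are the vertices `l ++ [j]` for `j : Fin d`, and the
leaves are the vertices of length exactly `k`. -/
abbrev Vtx (d k : ℕ) : Type := {l : List (Fin d) // l.length ≤ k}

/-- The root `v₀` of the tree. -/
def rootV (d k : ℕ) : Vtx d k := ⟨[], by simp⟩

/-- `L_M(d,k)`: the set of integer-valued `M`-Lipschitz functions on the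
`d`-ary tree of depth `k` that vanish on all leaves. -/
def LM (d k M : ℕ) : Set (Vtx d k → ℤ) :=
  {f | (∀ v : Vtx d k, v.1.length = k → f v = 0) ∧
       (∀ (l : List (Fin d)) (hl : l.length + 1 ≤ k) (j : Fin d),
         |f ⟨l ++ [j], by simpa using hl⟩ - f ⟨l, Nat.le_of_succ_le hl⟩| ≤ (M : ℤ))}

/-- `G(t,k)`: the number of functions in `L_M(d,k)` whose value at the root is `t`. -/
noncomputable def G (d k M : ℕ) (t : ℤ) : ℕ :=
  Nat.card {f : Vtx d k → ℤ // f ∈ LM d k M ∧ f (rootV d k) = t}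

/-- The probability that a uniformly random element of `L_M(d,k)` takes the
value `t` at the root. -/
noncomputable def PrRoot (d k M : ℕ) (t : ℤ) : ℝ :=
  (G d k M t : ℝ) / (Nat.card (LM d k M) : ℝ)

/-- The sum of `A` over the integer window of radius `M` centred at `t`. -/
def windowSum (M : ℕ) (A : ℤ → ℝ) (t : ℤ) : ℝ :=
  ∑ i ∈ Finset.range (2 * M + 1), A (t - M + i)

theorem windowSum_eq_sum_Icc (M : ℕ) (A : ℤ → ℝ) (t : ℤ) :
    windowSum M A t = ∑ s ∈ Finset.Icc (t - M) (t + M), A s := by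
  unfold windowSum
  refine Finset.sum_bij' (fun i _ => t - M + i) (fun s _ => (s - (t - M)).toNat) ?_ ?_ ?_ ?_ ?_
  · intro i hi
    simp only [Finset.mem_range, Finset.mem_Icc] at *
    omega
  · intro i hi
    simp only [Finset.mem_range, Finset.mem_Icc] at *
    omega
  · intro i hi
    simp
  · intro s hs
    simp only [Finset.mem_Icc] at hs
    omega
  · intro i hi
    rfl

theorem windowSum_nonneg (M : ℕ) {A : ℤ → ℝ} (hA : ∀ s, 0 ≤ A s) (t : ℤ) :
    0 ≤ windowSum M A t :=
  Finset.sum_nonneg fun _ _ => hA _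

theorem windowSum_neg (M : ℕ) {A : ℤ → ℝ} (hA : ∀ s, A (-s) = A s) (t : ℤ) :
    windowSum M A (-t) = windowSum M A t := by
  unfold windowSum
  rw [← Finset.sum_range_reflect]
  refine Finset.sum_congr rfl fun i hi => ?_
  rw [← hA]
  congr 1
  have := Finset.mem_range.1 hi
  omega

theorem windowSum_succ_le (M : ℕ) {A : ℤ → ℝ} (hA : ∀ s t, |s| ≤ |t| → A t ≤ A s)
    {t : ℤ} (ht : 0 ≤ t) : windowSum M A (t + 1) ≤ windowSum M A t := by
  unfold windowSum
  rw [Finset.sum_range_succ, Finset.sum_range_succ']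
  refine add_le_add (Finset.sum_le_sum fun i _ => le_of_eq ?_) (hA _ _ ?_)
  · congr 1
    push_cast
    ring
  · push_cast
    simp only [Int.abs_eq_natAbs]
    omega

/-- Window sums of a symmetric unimodal function are again symmetric and unimodal. -/
theorem windowSum_le_of_abs_le (M : ℕ) {A : ℤ → ℝ} (hA : ∀ s t, |s| ≤ |t| → A t ≤ A s)
    {s t : ℤ} (h : |s| ≤ |t|) : windowSum M A t ≤ windowSum M A s := by
  have heven : ∀ s, A (-s) = A s := fun s =>
    le_antisymm (hA _ _ (abs_neg s).ge) (hA _ _ (abs_neg s).le)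
  have habs : ∀ u, windowSum M A u = windowSum M A (u.natAbs : ℤ) := by
    intro u
    rcases Int.natAbs_eq u with hu | hu
    · rw [← hu]
    · conv_lhs => rw [hu]
      exact windowSum_neg M heven _
  have hanti : Antitone fun n : ℕ => windowSum M A (n : ℤ) := by
    refine antitone_nat_of_succ_le fun n => ?_
    push_cast
    exact windowSum_succ_le M hA (Int.natCast_nonneg n)
  rw [habs s, habs t]
  simp only [Int.abs_eq_natAbs] at h
  exact hanti (by omega)

theorem windowSum_eq_add (M : ℕ) (A : ℤ → ℝ) (t : ℤ) :
    windowSum M A t = ∑ i ∈ Finset.range M, A (t - M + i) +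
      ∑ i ∈ Finset.range M, A (t + i) + A (t + M) := by
  unfold windowSum
  rw [Finset.sum_range_succ, two_mul, Finset.sum_range_add]
  congr 1
  · congr 1
    refine Finset.sum_congr rfl fun i _ => ?_
    congr 1
    push_cast
    ring
  · congr 1
    push_cast
    ring

theorem windowSum_add_le (M : ℕ) {A : ℤ → ℝ} (hA : ∀ s t, |s| ≤ |t| → A t ≤ A s)
    (hnonneg : ∀ s, 0 ≤ A s) {c : ℝ} (hc : c ≤ 1 / 2)
    (hdecay : ∀ t : ℤ, 1 ≤ t → A (t + M) ≤ c * A t) {t : ℤ} (ht : 1 ≤ t) :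
    windowSum M A (t + M) ≤ 3 / 4 * windowSum M A t := by
  rw [windowSum_eq_add, windowSum_eq_add]
  have hlow : ∑ i ∈ Finset.range M, A (t + i) ≤ ∑ i ∈ Finset.range M, A (t - M + i) := by
    rw [← Finset.sum_range_reflect (fun i : ℕ => A (t - M + i))]
    refine Finset.sum_le_sum fun i hi => hA _ _ ?_
    have := Finset.mem_range.1 hi
    simp only [Int.abs_eq_natAbs]
    omega
  have hshift : ∑ i ∈ Finset.range M, A (t + M - M + i) = ∑ i ∈ Finset.range M, A (t + i) := by
    simp
  have hhigh : ∑ i ∈ Finset.range M, A (t + M + i) ≤ c * ∑ i ∈ Finset.range M, A (t + i) := by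
    rw [Finset.mul_sum]
    refine Finset.sum_le_sum fun i _ => ?_
    have := hdecay (t + i) (by omega)
    rwa [add_right_comm] at this
  have hend := hdecay (t + M) (by omega)
  have hP : 0 ≤ ∑ i ∈ Finset.range M, A (t + i) := Finset.sum_nonneg fun _ _ => hnonneg _
  have hE := hnonneg (t + M)
  rw [hshift]
  nlinarith [mul_le_mul_of_nonneg_right hc hP, mul_le_mul_of_nonneg_right hc hE]

/-- A function on the tree of depth `k + 1` with prescribed root value amounts to a `d`-tuple of
functions on the tree of depth `k`, one for each child of the root. -/
def subtreeEquiv (d k M : ℕ) (t : ℤ) :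
    {f : Vtx d (k + 1) → ℤ // f ∈ LM d (k + 1) M ∧ f (rootV d (k + 1)) = t} ≃
      (Fin d → {f : Vtx d k → ℤ // f ∈ LM d k M ∧
        f (rootV d k) ∈ Finset.Icc (t - M) (t + M)}) where
  toFun f j := ⟨fun v => f.1 ⟨j :: v.1, Nat.succ_le_succ v.2⟩,
    ⟨fun v hv => f.2.1.1 _ (congrArg Nat.succ hv),
      fun l hl i => f.2.1.2 (j :: l) (Nat.succ_le_succ hl) i⟩, by
    have h := f.2.1.2 [] (by simp) j
    have h0 := f.2.2
    change f.1 ⟨[], _⟩ = t at h0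
    rw [h0, abs_le] at h
    change f.1 ⟨[j], _⟩ ∈ _
    change -(M : ℤ) ≤ f.1 ⟨[j], _⟩ - t ∧ f.1 ⟨[j], _⟩ - t ≤ M at h
    rw [Finset.mem_Icc]
    constructor <;> linarith [h.1, h.2]⟩
  invFun F := ⟨fun v => match v with
      | ⟨[], _⟩ => t
      | ⟨j :: l, hl⟩ => (F j).1 ⟨l, Nat.le_of_succ_le_succ hl⟩, by
    refine ⟨⟨?_, ?_⟩, rfl⟩
    · rintro ⟨_ | ⟨j, l⟩, hl⟩ hv
      · simp at hv
      · exact (F j).2.1.1 _ (Nat.succ.inj hv)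
    · rintro (_ | ⟨j, l⟩) hl i
      · have h := Finset.mem_Icc.1 (F i).2.2
        change |(F i).1 (rootV d k) - t| ≤ _
        rw [abs_le]
        constructor <;> linarith [h.1, h.2]
      · exact (F j).2.1.2 l (Nat.le_of_succ_le_succ hl) i⟩
  left_inv f := by
    apply Subtype.ext
    funext ⟨l, hl⟩
    cases l with
    | nil => exact f.2.2.symm
    | cons j l => rfl
  right_inv F := rfl

/-- Classifying the functions with root value in a finite set by their root value. -/
def rootValueEquiv (d k M : ℕ) (I : Finset ℤ) :
    {f : Vtx d k → ℤ // f ∈ LM d k M ∧ f (rootV d k) ∈ I} ≃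
      Σ s : I, {f : Vtx d k → ℤ // f ∈ LM d k M ∧ f (rootV d k) = s} where
  toFun f := ⟨⟨f.1 (rootV d k), f.2.2⟩, f.1, f.2.1, rfl⟩
  invFun p := ⟨p.2.1, p.2.2.1, p.2.2.2.symm ▸ p.1.2⟩
  left_inv f := rfl
  right_inv := by
    rintro ⟨⟨s, hs⟩, f, hf, h⟩
    change f (rootV d k) = s at h
    subst h
    rfl

theorem eq_zero_of_mem_LM_zero {d M : ℕ} {f : Vtx d 0 → ℤ} (hf : f ∈ LM d 0 M) : f = 0 :=
  funext fun v => hf.1 v (Nat.le_zero.1 v.2)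

instance finite_LM_root (d k M : ℕ) (t : ℤ) :
    Finite {f : Vtx d k → ℤ // f ∈ LM d k M ∧ f (rootV d k) = t} := by
  induction k generalizing t with
  | zero =>
    have : Subsingleton {f : Vtx d 0 → ℤ // f ∈ LM d 0 M ∧ f (rootV d 0) = t} :=
      ⟨fun f g => Subtype.ext ((eq_zero_of_mem_LM_zero f.2.1).trans
        (eq_zero_of_mem_LM_zero g.2.1).symm)⟩
    infer_instance
  | succ k ih =>
    have := Finite.of_equiv _ (rootValueEquiv d k M (Finset.Icc (t - M) (t + M))).symm
    exact Finite.of_equiv _ (subtreeEquiv d k M t).symm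

theorem G_zero (d M : ℕ) (t : ℤ) : G d 0 M t = if t = 0 then 1 else 0 := by
  unfold G
  split_ifs with h
  · subst h
    rw [Nat.card_eq_one_iff_unique]
    refine ⟨⟨fun f g => Subtype.ext ((eq_zero_of_mem_LM_zero f.2.1).trans
      (eq_zero_of_mem_LM_zero g.2.1).symm)⟩, ⟨0, ⟨fun _ _ => rfl, fun l hl _ => ?_⟩, rfl⟩⟩
    omega
  · have : IsEmpty {f : Vtx d 0 → ℤ // f ∈ LM d 0 M ∧ f (rootV d 0) = t} :=
      ⟨fun f => h (f.2.2.symm.trans (f.2.1.1 _ rfl))⟩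
    exact Nat.card_of_isEmpty

theorem G_succ (d k M : ℕ) (t : ℤ) :
    (G d (k + 1) M t : ℝ) = windowSum M (fun s => (G d k M s : ℝ)) t ^ d := by
  rw [windowSum_eq_sum_Icc]
  unfold G
  rw [Nat.card_congr (subtreeEquiv d k M t), Nat.card_fun,
    Nat.card_congr (rootValueEquiv d k M _), Nat.card_sigma, Nat.card_fin]
  push_cast
  congr 1
  exact Finset.sum_coe_sort (Finset.Icc (t - (M : ℤ)) (t + M))
    fun s => (Nat.card {f : Vtx d k → ℤ // f ∈ LM d k M ∧ f (rootV d k) = s} : ℝ)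

theorem G_le_of_abs_le (d k M : ℕ) (s t : ℤ) (h : |s| ≤ |t|) :
    (G d k M t : ℝ) ≤ G d k M s := by
  induction k generalizing s t with
  | zero =>
    rw [G_zero, G_zero]
    by_cases ht : t = 0
    · have hs : s = 0 := by simpa [ht] using h
      simp [ht, hs]
    · rw [if_neg ht, Nat.cast_zero]
      positivity
  | succ k ih =>
    rw [G_succ, G_succ]
    exact pow_le_pow_left₀ (windowSum_nonneg M (fun _ => Nat.cast_nonneg _) t)
      (windowSum_le_of_abs_le M ih h) d

/-- **Exponential decay, `d ≥ 3`.**  For all `k, t ≥ 1`,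
`G(t+M,k) ≤ (3/4)^d * G(t,k)`. -/
theorem G_exp_decay_d_ge_three (d M : ℕ) (hd : 3 ≤ d) (hM : 1 ≤ M) (k : ℕ)
    (hk : 1 ≤ k) (t : ℤ) (ht : 1 ≤ t) :
    (G d k M (t + M) : ℝ) ≤ (3 / 4 : ℝ) ^ d * (G d k M t : ℝ) := by
  have hc : (3 / 4 : ℝ) ^ d ≤ 1 / 2 :=
    (pow_le_pow_of_le_one (by norm_num) (by norm_num) hd).trans (by norm_num)
  clear hk
  induction k generalizing t with
  | zero =>
    have h : t + M ≠ 0 := by omega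
    rw [G_zero, if_neg h, Nat.cast_zero]
    positivity
  | succ k ih =>
    rw [G_succ, G_succ, ← mul_pow]
    exact pow_le_pow_left₀ (windowSum_nonneg M (fun _ => Nat.cast_nonneg _) _)
      (windowSum_add_le M (G_le_of_abs_le d k M) (fun _ => Nat.cast_nonneg _) hc ih ht) d
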